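/- Let R be a commutative noetherian semi-local ring with maximal ideals m_1, ..., m_n that is complete with respect to the adic topology of its Jacobson radical m_1 ∩ ... ∩ m_n. Then the cosupport of R is exactly {m_1, ..., m_n}; that is, for a prime ideal p of R, there exists i with Ext^i_R(R_p, Λ^p R) ≠ 0 if and only if p is a maximal ideal. In particular, a complete noetherian local ring (R, m) has cosupport equal to {m}. -/

import Mathlib

open CategoryTheory Opposite

universe u

/-- The cosupport of a commutative ring `R`, as a subset of `Spec R`:
the primes `p` such that `Ext^i_R(R_p, Λ^p R) ≠ 0` for some `i`,
where `R_p` is the localization at `p` and `Λ^p R` the `p`-adic completion. -/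
noncomputable def ringCosupport (R : Type u) [CommRing R] : Set (PrimeSpectrum R) :=
  { p | ∃ i : ℕ, Nontrivial (((Ext R (ModuleCat.{u} R) i).obj
      (op (ModuleCat.of R (Localization.AtPrime p.asIdeal)))).obj
      (ModuleCat.of R (AdicCompletion p.asIdeal R))) }

/-- Every cocycle in the cochain complex `Hom(P, Y)` is a coboundary.
In degree `0` the truncated subtraction makes `P.d 0 (0 - 1)` the zero map. -/
def HomAcyclic {R : Type u} [CommRing R] (P : ChainComplex (ModuleCat.{u} R) ℕ)
    (Y : ModuleCat.{u} R) : Prop :=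
  ∀ (i : ℕ) (f : P.X i ⟶ Y), P.d (i + 1) i ≫ f = 0 → ∃ g : P.X (i - 1) ⟶ Y, P.d i (i - 1) ≫ g = f

section

variable {R : Type u} [CommRing R]

lemma subsingleton_ext_iff {X : ModuleCat.{u} R} (P : ProjectiveResolution X)
    (Y : ModuleCat.{u} R) (i : ℕ) :
    Subsingleton (((Ext R (ModuleCat.{u} R) i).obj (op X)).obj Y) ↔
      ∀ f : P.complex.X i ⟶ Y, P.complex.d (i + 1) i ≫ f = 0 →
        ∃ g : P.complex.X (i - 1) ⟶ Y, P.complex.d i (i - 1) ≫ g = f := by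
  rw [← ModuleCat.isZero_iff_subsingleton, (P.isoExt (R := R) i Y).isZero_iff,
    ← HomologicalComplex.exactAt_iff_isZero_homology,
    HomologicalComplex.exactAt_iff' _ (i - 1) i (i + 1) (by cases i <;> simp) (by simp),
    ShortComplex.moduleCat_exact_iff]
  rfl

lemma homAcyclic_iff {X : ModuleCat.{u} R} (P : ProjectiveResolution X) (Y : ModuleCat.{u} R) :
    HomAcyclic P.complex Y ↔
      ∀ i, Subsingleton (((Ext R (ModuleCat.{u} R) i).obj (op X)).obj Y) :=
  forall_congr' fun i ↦ (subsingleton_ext_iff P Y i).symm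

lemma HomAcyclic.of_iso {P : ChainComplex (ModuleCat.{u} R) ℕ} {Y Z : ModuleCat.{u} R}
    (h : HomAcyclic P Y) (e : Y ≅ Z) : HomAcyclic P Z := by
  intro i f hf
  obtain ⟨g, hg⟩ := h i (f ≫ e.inv) (by rw [← Category.assoc, hf, Limits.zero_comp])
  exact ⟨g ≫ e.hom, by rw [← Category.assoc, hg, Category.assoc, e.inv_hom_id, Category.comp_id]⟩

/-- If `x` acts invertibly on `X` and is zero on `Y`, then `Ext^i(X, Y) = 0` for all `i`. -/
lemma homAcyclic_of_smul_eq_zero {X Y : ModuleCat.{u} R} (P : ProjectiveResolution X) (x : R)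
    (φ : X ⟶ X) (hφ : x • φ = 𝟙 X) (hY : x • 𝟙 Y = 0) : HomAcyclic P.complex Y := by
  intro i f hf
  let L := ProjectiveResolution.lift φ P P
  let H : Homotopy (𝟙 P.complex) (x • L) := ProjectiveResolution.liftHomotopy (𝟙 X) _ _ (by simp)
    (by rw [Linear.smul_comp, ProjectiveResolution.lift_commutes, ← Linear.comp_smul,
          ← hφ]
        congr 1
        ext
        rfl)
  have hc := congrArg (· ≫ f) (H.comm i)
  have hx : x • f = 0 := by
    rw [← Category.comp_id f, ← Linear.comp_smul, hY, Limits.comp_zero]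
  refine ⟨H.hom (i - 1) i ≫ f, ?_⟩
  have h₁ : (x • L).f i ≫ f = 0 := by
    rw [HomologicalComplex.smul_f_apply, Linear.smul_comp, ← Linear.comp_smul, hx,
      Limits.comp_zero]
  have h₂ : prevD i H.hom ≫ f = 0 := by
    rw [Homotopy.prevD_chainComplex, Category.assoc, hf, Limits.comp_zero]
  simp only [Preadditive.add_comp, h₁, h₂, add_zero, dNext_nat, Category.assoc] at hc
  simpa using hc.symm

/-- Vanishing of `Ext` into all the quotients `M / I ^ n M` passes to the `I`-adic completion. -/
lemma HomAcyclic.adicCompletion {X : ModuleCat.{u} R} (P : ProjectiveResolution X)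
    (I : Ideal R) (M : Type u) [AddCommGroup M] [Module R M]
    (h : ∀ n : ℕ, HomAcyclic P.complex (ModuleCat.of R (M ⧸ (I ^ n • ⊤ : Submodule R M)))) :
    HomAcyclic P.complex (ModuleCat.of R (AdicCompletion I M)) := by
  intro i f hf
  let ev (n : ℕ) : ModuleCat.of R (AdicCompletion I M) ⟶
      ModuleCat.of R (M ⧸ (I ^ n • ⊤ : Submodule R M)) :=
    ModuleCat.ofHom (AdicCompletion.eval I M n)
  let t (n : ℕ) : ModuleCat.of R (M ⧸ (I ^ (n + 1) • ⊤ : Submodule R M)) ⟶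
      ModuleCat.of R (M ⧸ (I ^ n • ⊤ : Submodule R M)) :=
    ModuleCat.ofHom (AdicCompletion.transitionMap I M n.le_succ)
  have ht (n : ℕ) : Epi (t n) := by
    rw [ModuleCat.epi_iff_surjective]
    exact Submodule.factor_surjective
      (Submodule.smul_mono_left (Ideal.pow_le_pow_right n.le_succ))
  have hev (n : ℕ) : ev (n + 1) ≫ t n = ev n :=
    ModuleCat.hom_ext (AdicCompletion.transitionMap_comp_eval I M n.le_succ)
  have hext {Z : ModuleCat.{u} R} (a b : Z ⟶ ModuleCat.of R (AdicCompletion I M))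
      (hab : ∀ n, a ≫ ev n = b ≫ ev n) : a = b := by
    refine ModuleCat.hom_ext (LinearMap.ext fun z ↦ AdicCompletion.ext fun n ↦ ?_)
    exact congrArg (fun k ↦ k.hom z) (hab n)
  have hfev (n : ℕ) : P.complex.d (i + 1) i ≫ f ≫ ev n = 0 := by
    rw [← Category.assoc, hf, Limits.zero_comp]
  obtain _ | j := i
  · refine ⟨0, hext _ _ fun n ↦ ?_⟩
    obtain ⟨g, hg⟩ := h n 0 (f ≫ ev n) (hfev n)
    rw [← hg]
    simp
  let S (n : ℕ) := { g : P.complex.X j ⟶ ModuleCat.of R (M ⧸ (I ^ n • ⊤ : Submodule R M)) //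
    P.complex.d (j + 1) j ≫ g = f ≫ ev n }
  have step (n : ℕ) (s : S n) : ∃ s' : S (n + 1), s'.1 ≫ t n = s.1 := by
    obtain ⟨g', hg'⟩ : ∃ g' : P.complex.X j ⟶ _, P.complex.d (j + 1) j ≫ g' = f ≫ ev (n + 1) :=
      h (n + 1) (j + 1) (f ≫ ev (n + 1)) (hfev _)
    obtain ⟨k, hk⟩ := h n j (g' ≫ t n - s.1) (by
      rw [Preadditive.comp_sub, s.2, ← Category.assoc, hg', Category.assoc, hev, sub_self])
    let k' := Projective.factorThru k (t n)
    refine ⟨⟨g' - P.complex.d j (j - 1) ≫ k', ?_⟩, ?_⟩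
    · rw [Preadditive.comp_sub, hg', ← Category.assoc, HomologicalComplex.d_comp_d,
        Limits.zero_comp, sub_zero]
    · rw [Preadditive.sub_comp, Category.assoc, Projective.factorThru_comp, hk, sub_sub_cancel]
  choose next hnext using step
  obtain ⟨g₀, hg₀⟩ := h 0 (j + 1) (f ≫ ev 0) (hfev 0)
  let s (n : ℕ) : S n := Nat.rec ⟨g₀, hg₀⟩ next n
  have hs (n : ℕ) : (s (n + 1)).1 ≫ t n = (s n).1 := hnext n (s n)
  let G : P.complex.X j →ₗ[R] AdicCompletion I M :=
    AdicCompletion.lift I (fun n ↦ (s n).1.hom) fun hle ↦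
      IsAdicComplete.StrictMono.factorPow_comp_eq_of_factorPow_comp_succ_eq (a := id) strictMono_id
        (fun n ↦ (s n).1.hom) (fun {m} ↦ congrArg ModuleCat.Hom.hom (hs m)) hle
  exact ⟨ModuleCat.ofHom G, hext _ _ fun n ↦ (s n).2⟩

lemma IsPrecomplete.of_surjective (I : Ideal R) {M N : Type*} [AddCommGroup M] [Module R M]
    [AddCommGroup N] [Module R N] [IsPrecomplete I M] (f : M →ₗ[R] N)
    (hf : Function.Surjective f) : IsPrecomplete I N := by
  rw [← AdicCompletion.of_surjective_iff]
  intro y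
  obtain ⟨z, rfl⟩ := AdicCompletion.map_surjective I hf y
  obtain ⟨x, rfl⟩ := AdicCompletion.of_surjective I M z
  exact ⟨f x, rfl⟩

/-- If `M` is `J`-adically complete and some `x ∈ J` acts invertibly on `X`, then
`Ext^i(X, M) = 0` for all `i`. -/
lemma homAcyclic_of_isAdicComplete {X : ModuleCat.{u} R} (P : ProjectiveResolution X)
    (J : Ideal R) (M : Type u) [AddCommGroup M] [Module R M] [IsAdicComplete J M]
    {x : R} (hx : x ∈ J) (φ : X ⟶ X) (hφ : x • φ = 𝟙 X) :
    HomAcyclic P.complex (ModuleCat.of R M) := by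
  refine HomAcyclic.of_iso (HomAcyclic.adicCompletion P J M fun n ↦ ?_)
    (AdicCompletion.ofLinearEquiv J M).symm.toModuleIso
  have hpow (n : ℕ) : ∃ ψ : X ⟶ X, x ^ n • ψ = 𝟙 X := by
    induction n with
    | zero => exact ⟨𝟙 X, by simp⟩
    | succ n ih =>
      obtain ⟨ψ, hψ⟩ := ih
      refine ⟨φ ≫ ψ, ?_⟩
      rw [pow_succ, mul_smul, ← Linear.smul_comp, hφ, Category.id_comp, hψ]
  obtain ⟨ψ, hψ⟩ := hpow n
  refine homAcyclic_of_smul_eq_zero P (x ^ n) ψ hψ (ModuleCat.hom_ext (LinearMap.ext fun m ↦ ?_))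
  obtain ⟨m, rfl⟩ := Submodule.Quotient.mk_surjective _ m
  exact (Submodule.Quotient.mk_eq_zero _).2
    (Submodule.smul_mem_smul (Ideal.pow_mem_pow hx n) Submodule.mem_top)

/-- If `R` is noetherian and complete for the `J`-adic topology, and some `x ∈ J` acts invertibly
on `X`, then `Ext^i(X, Λ^p R) = 0` for all `i` and all ideals `p`. -/
lemma homAcyclic_adicCompletion [IsNoetherianRing R] {X : ModuleCat.{u} R}
    (P : ProjectiveResolution X) (J p : Ideal R) [IsAdicComplete J R]
    {x : R} (hx : x ∈ J) (φ : X ⟶ X) (hφ : x • φ = 𝟙 X) :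
    HomAcyclic P.complex (ModuleCat.of R (AdicCompletion p R)) := by
  refine HomAcyclic.adicCompletion P p R fun n ↦ ?_
  have : IsHausdorff J (R ⧸ (p ^ n • ⊤ : Submodule R R)) :=
    .of_le_jacobson J _ (IsAdicComplete.le_jacobson_bot J)
  have : IsPrecomplete J (R ⧸ (p ^ n • ⊤ : Submodule R R)) :=
    .of_surjective J (Submodule.mkQ _) (Submodule.mkQ_surjective _)
  have : IsAdicComplete J (R ⧸ (p ^ n • ⊤ : Submodule R R)) := {}
  exact homAcyclic_of_isAdicComplete P J _ hx φ hφ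

lemma nontrivial_ext_zero {X Y : ModuleCat.{u} R} (f : X ⟶ Y) (hf : f ≠ 0) :
    Nontrivial (((Ext R (ModuleCat.{u} R) 0).obj (op X)).obj Y) := by
  let P := projectiveResolution X
  let π : P.complex.X 0 ⟶ X := P.π.f 0
  have hπ : P.complex.d 1 0 ≫ π = 0 := P.complex_d_comp_π_f_zero
  have : Epi π := inferInstanceAs (Epi (P.π.f 0))
  rw [← not_subsingleton_iff_nontrivial, subsingleton_ext_iff P]
  intro h
  obtain ⟨g, hg⟩ := h (π ≫ f) (by rw [← Category.assoc, hπ, Limits.zero_comp])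
  refine hf ((cancel_epi π).1 ?_)
  rw [← hg, P.complex.shape 0 (0 - 1) (by simp), Limits.zero_comp, Limits.comp_zero]

lemma AdicCompletion.isUnit_algebraMap_of_notMem {m : Ideal R} [m.IsMaximal] (hm : m.FG)
    {s : R} (hs : s ∉ m) : IsUnit (algebraMap R (AdicCompletion m R) s) := by
  have := AdicCompletion.isMaximal_map_of_le m m le_rfl hm
  have := AdicCompletion.isAdicComplete_self m hm
  have := isLocalRing_of_isAdicComplete_maximal (m.map (algebraMap R (AdicCompletion m R)))
  rw [← IsLocalRing.notMem_maximalIdeal,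
    ← IsLocalRing.eq_maximalIdeal (AdicCompletion.isMaximal_map_of_le m m le_rfl hm)]
  intro h
  have h₁ := Ideal.mem_map_of_mem (AdicCompletion.evalOneₐ m).toRingHom h
  rw [Ideal.map_map, AdicCompletion.evalOneₐ_comp_algebraMap_eq_mk, Ideal.map_quotient_self,
    Ideal.mem_bot] at h₁
  exact hs (Ideal.Quotient.eq_zero_iff_mem.1 h₁)

lemma mem_ringCosupport_of_isMaximal [IsNoetherianRing R] (p : PrimeSpectrum R)
    (hp : p.asIdeal.IsMaximal) : p ∈ ringCosupport R := by
  let F : Localization.AtPrime p.asIdeal →ₐ[R] AdicCompletion p.asIdeal R :=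
    IsLocalization.liftAlgHom (M := p.asIdeal.primeCompl) (f := Algebra.ofId R _)
      fun s ↦ AdicCompletion.isUnit_algebraMap_of_notMem
        p.asIdeal.fg_of_isNoetherianRing s.2
  have : Nontrivial (AdicCompletion p.asIdeal R) :=
    (AdicCompletion.evalOneₐ p.asIdeal).toRingHom.domain_nontrivial
  refine ⟨0, nontrivial_ext_zero (ModuleCat.ofHom F.toLinearMap) fun h ↦ ?_⟩
  have h₁ : F 1 = 0 := congrArg (fun k ↦ k.hom (1 : Localization.AtPrime p.asIdeal)) h
  exact one_ne_zero ((map_one F).symm.trans h₁)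

lemma Ideal.not_jacobson_bot_le_of_finite (hfin : { m : Ideal R | m.IsMaximal }.Finite)
    (p : Ideal R) [hp : p.IsPrime] (hpm : ¬ p.IsMaximal) : ¬ (⊥ : Ideal R).jacobson ≤ p := by
  intro h
  have h₁ : hfin.toFinset.inf id ≤ p := by
    refine le_trans (le_sInf fun m hm ↦ ?_) h
    exact Finset.inf_le (f := id) (hfin.mem_toFinset.2 hm.2)
  obtain ⟨m, hm, hle⟩ := (Ideal.IsPrime.inf_le' hp).1 h₁
  have hm' : m.IsMaximal := hfin.mem_toFinset.1 hm
  exact hpm (hm'.eq_of_le hp.ne_top hle ▸ hm')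

end

/-!
STATEMENT 11: Let `R` be a commutative noetherian semi-local ring (finitely many
maximal ideals) that is complete with respect to the adic topology of its Jacobson
radical (the intersection of its maximal ideals).  Then the cosupport of `R` consists
exactly of its maximal ideals.
-/
theorem cosupport_complete_semilocal (R : Type u) [CommRing R] [IsNoetherianRing R]
    (hfin : { m : Ideal R | m.IsMaximal }.Finite)
    (hc : IsAdicComplete ((⊥ : Ideal R).jacobson) R) :
    ∀ p : PrimeSpectrum R, p ∈ ringCosupport R ↔ p.asIdeal.IsMaximal := by
  intro p
  refine ⟨fun ⟨i, hi⟩ ↦ ?_, mem_ringCosupport_of_isMaximal p⟩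
  by_contra hpm
  obtain ⟨x, hxJ, hxp⟩ :=
    SetLike.not_le_iff_exists.1 (Ideal.not_jacobson_bot_le_of_finite hfin p.asIdeal hpm)
  have hu : IsUnit (algebraMap R (Localization.AtPrime p.asIdeal) x) :=
    IsLocalization.map_units _ (⟨x, hxp⟩ : p.asIdeal.primeCompl)
  obtain ⟨y, hy⟩ := hu.exists_right_inv
  let X := ModuleCat.of R (Localization.AtPrime p.asIdeal)
  let φ : X ⟶ X := ModuleCat.ofHom (LinearMap.mulLeft R y)
  have hφ : x • φ = 𝟙 X := ModuleCat.hom_ext <| LinearMap.ext fun z ↦ by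
    change x • (y * z) = z
    rw [Algebra.smul_def, ← mul_assoc, hy, one_mul]
  exact not_subsingleton_iff_nontrivial.2 hi ((homAcyclic_iff (projectiveResolution X) _).1
    (homAcyclic_adicCompletion _ _ p.asIdeal hxJ φ hφ) i)
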